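/- The sub-level sets Ω_c = {ξ̄ ∈ Ω : E(ξ̄) ≤ c} are compact for every c ∈ ℝ if and only if the coercivity conditions hold: S^j = Σ_{i=1}^{j} [κ_{i−1}(u_i−u_{i−1}) + d_i] ≥ 0 for all j = 1,…,n, and S_j = Σ_{i=j}^{n} [κ_i(u_{i+1}−u_i) + d_i] ≥ 0 for all j = 1,…,n. -/

import Mathlib

open Real Filter Finset

/-- The rescaled Gaussian cumulative distribution function
`F(ξ) = (1/(2√π)) ∫_{-∞}^{ξ} e^{-s²/4} ds`. -/
noncomputable def F (x : ℝ) : ℝ :=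
  (1 / (2 * Real.sqrt Real.pi)) * ∫ s in Set.Iio x, Real.exp (-s ^ 2 / 4)

/-- The derivative `F'(ξ) = (1/(2√π)) e^{-ξ²/4}`. -/
noncomputable def F' (x : ℝ) : ℝ :=
  (1 / (2 * Real.sqrt Real.pi)) * Real.exp (-x ^ 2 / 4)

/-- The functional
`E(ξ̄) = −Σ_{i=0}^{n} k_i(u_{i+1}−u_i) ln(F(ξ_{i+1}/a_i) − F(ξ_i/a_i)) + Σ_{i=1}^{n} d_i ξ_i²/4`,
with the conventions `ξ₀ = −∞`, `ξ_{n+1} = +∞`, i.e. `F(ξ₀/a₀) = 0`, `F(ξ_{n+1}/a_n) = 1`.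
Here `ξ : ℕ → ℝ`, only the values `ξ 1, …, ξ n` being relevant. -/
noncomputable def E (n : ℕ) (u a k d : ℕ → ℝ) (ξ : ℕ → ℝ) : ℝ :=
  -(∑ i ∈ Finset.range (n + 1), k i * (u (i + 1) - u i) *
      Real.log ((if i = n then 1 else F (ξ (i + 1) / a i)) -
        (if i = 0 then 0 else F (ξ i / a i))))
  + ∑ i ∈ Finset.Icc 1 n, d i * ξ i ^ 2 / 4

/-- Reindexing of a point of `ℝⁿ` as the sequence `ξ_1, …, ξ_n` (paper indexing). -/
noncomputable def toSeq (n : ℕ) (x : EuclideanSpace ℝ (Fin n)) : ℕ → ℝ :=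
  fun i => if h : i - 1 < n then x ⟨i - 1, h⟩ else 0

/-- The left-hand side of the `i`-th equation (`1 ≤ i ≤ n`) of the Stefan system:
`d_i ξ_i/2 + k_i(u_{i+1}−u_i) F'(ξ_i/a_i)/(a_i (F(ξ_{i+1}/a_i) − F(ξ_i/a_i)))
 − k_{i−1}(u_i−u_{i−1}) F'(ξ_i/a_{i−1})/(a_{i−1} (F(ξ_i/a_{i−1}) − F(ξ_{i−1}/a_{i−1})))`,
with the conventions `ξ₀ = −∞` (so `F(ξ₀/a₀) = 0`) and `ξ_{n+1} = +∞` (so `F(ξ_{n+1}/a_n) = 1`). -/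
noncomputable def stefanLHS (n : ℕ) (u a k d : ℕ → ℝ) (ξ : ℕ → ℝ) (i : ℕ) : ℝ :=
  d i * ξ i / 2
  + k i * (u (i + 1) - u i) * F' (ξ i / a i) /
      (a i * ((if i = n then 1 else F (ξ (i + 1) / a i)) - F (ξ i / a i)))
  - k (i - 1) * (u i - u (i - 1)) * F' (ξ i / a (i - 1)) /
      (a (i - 1) * (F (ξ i / a (i - 1)) - (if i = 1 then 0 else F (ξ (i - 1) / a (i - 1)))))

lemma integrable_gauss : MeasureTheory.Integrable (fun s : ℝ => Real.exp (-s ^ 2 / 4)) := by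
  have h := integrable_exp_neg_mul_sq (b := 1 / 4) (by norm_num)
  refine h.congr (Filter.Eventually.of_forall fun s => ?_)
  simp only
  congr 1
  ring

lemma integral_gauss : ∫ s : ℝ, Real.exp (-s ^ 2 / 4) = 2 * √π := by
  have h := integral_gaussian (1 / 4)
  rw [show π / (1 / 4) = 2 ^ 2 * π by ring, Real.sqrt_mul (by norm_num),
    Real.sqrt_sq (by norm_num)] at h
  rw [← h]
  congr 1
  ext s
  congr 1
  ring

lemma F_eq_Iic (x : ℝ) :
    F x = (1 / (2 * √π)) * ∫ s in Set.Iic x, Real.exp (-s ^ 2 / 4) := by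
  rw [F, MeasureTheory.integral_Iic_eq_integral_Iio]

lemma F_sub (x y : ℝ) :
    F y - F x = (1 / (2 * √π)) * ∫ s in x..y, Real.exp (-s ^ 2 / 4) := by
  rw [F_eq_Iic, F_eq_Iic, ← mul_sub, intervalIntegral.integral_Iic_sub_Iic
    integrable_gauss.integrableOn integrable_gauss.integrableOn]

lemma F_neg (x : ℝ) : F (-x) = 1 - F x := by
  have h1 : ∫ s in Set.Iic (-x), Real.exp (-s ^ 2 / 4)
      = ∫ s in Set.Ioi x, Real.exp (-s ^ 2 / 4) := by
    have := integral_comp_neg_Ioi x (fun s : ℝ => Real.exp (-s ^ 2 / 4))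
    simpa using this.symm
  have h2 := intervalIntegral.integral_Iic_add_Ioi (b := x)
    integrable_gauss.integrableOn integrable_gauss.integrableOn
  rw [integral_gauss] at h2
  have h3 : (0 : ℝ) < √π := by positivity
  rw [F_eq_Iic, F_eq_Iic, h1, eq_sub_of_add_eq' h2]
  field_simp

lemma mul_F'_le_F_sub {x y M : ℝ} (hxy : x ≤ y) (hx : x ^ 2 ≤ M) (hy : y ^ 2 ≤ M) :
    (y - x) * (1 / (2 * √π) * Real.exp (-M / 4)) ≤ F y - F x := by
  rw [F_sub, mul_left_comm]
  gcongr
  have h : ∫ _ in x..y, Real.exp (-M / 4) ≤ ∫ s in x..y, Real.exp (-s ^ 2 / 4) := by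
    refine intervalIntegral.integral_mono_on hxy (by simp)
      integrable_gauss.intervalIntegrable fun s hs => ?_
    gcongr
    obtain ⟨h1, h2⟩ := hs
    rcases le_total 0 s with h0 | h0 <;> nlinarith
  simpa using h

lemma F_strictMono : StrictMono F := by
  intro x y hxy
  have h := mul_F'_le_F_sub hxy.le (le_max_left (x ^ 2) (y ^ 2)) (le_max_right _ _)
  have : 0 < (y - x) * (1 / (2 * √π) * Real.exp (-(max (x ^ 2) (y ^ 2)) / 4)) :=
    mul_pos (sub_pos.2 hxy) (by positivity)
  linarith

lemma F_continuous : Continuous F := by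
  have h : F = fun y => (1 / (2 * √π)) * (∫ s in (0 : ℝ)..y, Real.exp (-s ^ 2 / 4)) + F 0 := by
    ext y
    rw [← F_sub]
    ring
  rw [h]
  exact ((intervalIntegral.continuous_primitive
    (fun _ _ => integrable_gauss.intervalIntegrable) 0).const_mul _).add_const _

lemma F_pos (x : ℝ) : 0 < F x := by
  have h : 0 ≤ F (x - 1) := by
    unfold F
    exact mul_nonneg (by positivity)
      (MeasureTheory.integral_nonneg fun _ => (Real.exp_pos _).le)
  exact h.trans_lt (F_strictMono (by linarith))

lemma F_lt_one (x : ℝ) : F x < 1 := by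
  linarith [F_pos (-x), F_neg x]

lemma F_le_exp {x : ℝ} (hx : x ≤ 0) : F x ≤ Real.exp (-x ^ 2 / 4) := by
  have h : ∫ s in Set.Iio x, Real.exp (-s ^ 2 / 4)
      ≤ Real.exp (-x ^ 2 / 4) * (2 * √π) := by
    have hi := (integrable_gauss.comp_sub_right x).const_mul (Real.exp (-x ^ 2 / 4))
    calc ∫ s in Set.Iio x, Real.exp (-s ^ 2 / 4)
        ≤ ∫ s in Set.Iio x, Real.exp (-x ^ 2 / 4) * Real.exp (-(s - x) ^ 2 / 4) := by
          refine MeasureTheory.setIntegral_mono_on integrable_gauss.integrableOn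
            hi.integrableOn measurableSet_Iio fun s hs => ?_
          rw [← Real.exp_add]
          gcongr
          have : s < x := hs
          nlinarith
      _ ≤ ∫ s, Real.exp (-x ^ 2 / 4) * Real.exp (-(s - x) ^ 2 / 4) :=
          MeasureTheory.setIntegral_le_integral hi
            (Filter.Eventually.of_forall fun s => by positivity)
      _ = Real.exp (-x ^ 2 / 4) * (2 * √π) := by
          rw [MeasureTheory.integral_const_mul,
            MeasureTheory.integral_sub_right_eq_self (fun s : ℝ => Real.exp (-s ^ 2 / 4)),
            integral_gauss]
  have h3 : (0 : ℝ) < √π := by positivity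
  unfold F
  rw [one_div, inv_mul_le_iff₀ (by positivity)]
  linarith

lemma F_neg_le_exp_div {x : ℝ} (hx : 0 < x) : F (-x) ≤ Real.exp (-x ^ 2 / 4) / x := by
  have h : ∫ s in Set.Iic (-x), Real.exp (-s ^ 2 / 4)
      ≤ Real.exp (x ^ 2 / 4) * (Real.exp (x / 2 * -x) / (x / 2)) := by
    have hi := (integrableOn_exp_mul_Iic (half_pos hx) (-x)).const_mul (Real.exp (x ^ 2 / 4))
    calc ∫ s in Set.Iic (-x), Real.exp (-s ^ 2 / 4)
        ≤ ∫ s in Set.Iic (-x), Real.exp (x ^ 2 / 4) * Real.exp (x / 2 * s) := by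
          refine MeasureTheory.setIntegral_mono_on integrable_gauss.integrableOn
            hi measurableSet_Iic fun s hs => ?_
          rw [← Real.exp_add]
          gcongr
          nlinarith [sq_nonneg (s + x)]
      _ = _ := by
          rw [MeasureTheory.integral_const_mul, integral_exp_mul_Iic (half_pos hx)]
  have h3 : (1 : ℝ) ≤ √π := by
    rw [Real.one_le_sqrt]
    linarith [Real.pi_gt_three]
  have h4 : Real.exp (x ^ 2 / 4) * (Real.exp (x / 2 * -x) / (x / 2))
      = 2 * (Real.exp (-x ^ 2 / 4) / x) := by
    rw [mul_div_assoc', ← Real.exp_add]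
    field_simp
    congr 1
    ring
  have h5 : 0 < Real.exp (-x ^ 2 / 4) / x := by positivity
  rw [F_eq_Iic, one_div, inv_mul_le_iff₀ (by positivity)]
  nlinarith

lemma log_F_le (x : ℝ) : Real.log (F x) ≤ -(max (-x) 0) ^ 2 / 4 := by
  rw [Real.log_le_iff_le_exp (F_pos x)]
  rcases le_total x 0 with h | h
  · rw [max_eq_left (by linarith), neg_sq]
    exact F_le_exp h
  · rw [max_eq_right (by linarith)]
    simpa using (F_lt_one x).le

lemma log_one_sub_F_le (x : ℝ) : Real.log (1 - F x) ≤ -(max x 0) ^ 2 / 4 := by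
  simpa [F_neg] using log_F_le (-x)

lemma log_F_neg_le {x : ℝ} (hx : 0 < x) :
    Real.log (F (-x)) ≤ -x ^ 2 / 4 - Real.log x := by
  rw [Real.log_le_iff_le_exp (F_pos _), Real.exp_sub, Real.exp_log hx]
  exact F_neg_le_exp_div hx

/-- The argument of the logarithm in the `i`-th term of `E`. -/
noncomputable def cell (n : ℕ) (a ξ : ℕ → ℝ) (i : ℕ) : ℝ :=
  (if i = n then 1 else F (ξ (i + 1) / a i)) - (if i = 0 then 0 else F (ξ i / a i))

lemma E_eq_sum_cell (n : ℕ) (u a k d ξ : ℕ → ℝ) :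
    E n u a k d ξ =
      ∑ i ∈ range (n + 1), k i * (u (i + 1) - u i) * -Real.log (cell n a ξ i)
        + ∑ i ∈ Icc 1 n, d i * ξ i ^ 2 / 4 := by
  simp only [E, cell, mul_neg, sum_neg_distrib]

section Cell

variable {n i : ℕ} {a ξ : ℕ → ℝ}

lemma cell_pos (hn : 1 ≤ n) (hi : i ≤ n) (ha : 0 < a i)
    (hξ : ∀ i, 1 ≤ i → i < n → ξ i < ξ (i + 1)) : 0 < cell n a ξ i := by
  unfold cell
  split_ifs with h1 h2 h2
  · omega
  · linarith [F_lt_one (ξ i / a i)]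
  · linarith [F_pos (ξ (i + 1) / a i)]
  · exact sub_pos.2 (F_strictMono
      (div_lt_div_of_pos_right (hξ i (by omega) (by omega)) ha))

lemma cell_le_F (h : i ≠ n) : cell n a ξ i ≤ F (ξ (i + 1) / a i) := by
  rw [cell, if_neg h]
  split_ifs
  · simp
  · linarith [F_pos (ξ i / a i)]

lemma cell_le_one_sub_F (h : i ≠ 0) : cell n a ξ i ≤ 1 - F (ξ i / a i) := by
  rw [cell, if_neg h]
  split_ifs
  · simp
  · linarith [F_lt_one (ξ (i + 1) / a i)]

lemma cell_le_one : cell n a ξ i ≤ 1 := by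
  unfold cell
  split_ifs
  · simp
  · linarith [F_pos (ξ i / a i)]
  · linarith [F_lt_one (ξ (i + 1) / a i)]
  · linarith [F_pos (ξ i / a i), F_lt_one (ξ (i + 1) / a i)]

lemma lt_of_cell_pos (h1 : 1 ≤ i) (h2 : i < n) (ha : 0 < a i) (h : 0 < cell n a ξ i) :
    ξ i < ξ (i + 1) := by
  rw [cell, if_neg (by omega), if_neg (by omega), sub_pos, F_strictMono.lt_iff_lt] at h
  exact (div_lt_div_iff_of_pos_right ha).1 h

/-- The square of the positive part of `ξ i`, with the convention `ξ 0 = -∞`. -/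
noncomputable def posSq (ξ : ℕ → ℝ) (i : ℕ) : ℝ := if i = 0 then 0 else max (ξ i) 0 ^ 2

/-- The square of the negative part of `ξ i`, with the convention `ξ (n + 1) = +∞`. -/
noncomputable def negSq (n : ℕ) (ξ : ℕ → ℝ) (i : ℕ) : ℝ :=
  if i = n + 1 then 0 else max (-ξ i) 0 ^ 2

lemma max_div_zero (x : ℝ) {b : ℝ} (hb : 0 < b) : max (x / b) 0 = max x 0 / b := by
  rw [max_div_div_right hb.le x 0 |>.symm, zero_div]

lemma log_cell_le (hn : 1 ≤ n) (hi : i ≤ n) (ha : 0 < a i)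
    (hξ : ∀ i, 1 ≤ i → i < n → ξ i < ξ (i + 1)) :
    Real.log (cell n a ξ i) ≤ -((posSq ξ i + negSq n ξ (i + 1)) / (4 * a i ^ 2)) := by
  have hpos := cell_pos hn hi ha hξ
  by_cases h : i ≠ 0 ∧ 0 ≤ ξ i
  · have hq : negSq n ξ (i + 1) = 0 := by
      unfold negSq
      split_ifs with h1
      · rfl
      · rw [max_eq_right (by linarith [hξ i (by omega) (by omega)])]
        simp
    have := (Real.log_le_log hpos (cell_le_one_sub_F h.1)).trans (log_one_sub_F_le _)
    rw [max_div_zero _ ha] at this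
    rw [hq, posSq, if_neg h.1]
    refine this.trans (le_of_eq ?_)
    field_simp
    ring
  · have hp : posSq ξ i = 0 := by
      unfold posSq
      split_ifs with h1
      · rfl
      · rw [max_eq_right (by by_contra! h2; exact h ⟨h1, h2.le⟩)]
        simp
    rw [hp, negSq]
    split_ifs with h1
    · simpa using Real.log_nonpos hpos.le cell_le_one
    · have := (Real.log_le_log hpos (cell_le_F (by omega))).trans (log_F_le _)
      rw [← neg_div, max_div_zero _ ha] at this
      refine this.trans (le_of_eq ?_)
      field_simp
      ring

end Cell

lemma sum_Icc_one_eq (n : ℕ) (f : ℕ → ℝ) : ∑ i ∈ Icc 1 n, f i = ∑ i ∈ range n, f (i + 1) := by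
  rw [range_eq_Ico, sum_Ico_add' f 0 n 1]
  rfl

lemma sum_Icc_mul_nonneg_of_antitone {n : ℕ} {c g : ℕ → ℝ}
    (hc : ∀ j, 1 ≤ j → j ≤ n → 0 ≤ ∑ i ∈ Icc 1 j, c i)
    (hg : ∀ j, 1 ≤ j → j < n → g (j + 1) ≤ g j) (hg0 : ∀ j, 0 ≤ g j) :
    0 ≤ ∑ i ∈ Icc 1 n, c i * g i := by
  suffices h : ∀ j, 1 ≤ j → j ≤ n → g j * ∑ i ∈ Icc 1 j, c i ≤ ∑ i ∈ Icc 1 j, c i * g i by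
    rcases Nat.eq_zero_or_pos n with rfl | hn
    · simp
    · exact (mul_nonneg (hg0 n) (hc n hn le_rfl)).trans (h n hn le_rfl)
  intro j hj
  induction j, hj using Nat.le_induction with
  | base => simp [mul_comm]
  | succ j hj ih =>
    intro hjn
    rw [sum_Icc_succ_top (by omega), sum_Icc_succ_top (by omega)]
    have := mul_le_mul_of_nonneg_right (hg j hj hjn) (hc j hj (by omega))
    linarith [ih (by omega)]

lemma sum_Icc_mul_nonneg_of_monotone {n : ℕ} {c g : ℕ → ℝ}
    (hc : ∀ j, 1 ≤ j → j ≤ n → 0 ≤ ∑ i ∈ Icc j n, c i)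
    (hg : ∀ j, 1 ≤ j → j < n → g j ≤ g (j + 1)) (hg0 : ∀ j, 0 ≤ g j) :
    0 ≤ ∑ i ∈ Icc 1 n, c i * g i := by
  rcases Nat.eq_zero_or_pos n with rfl | hn
  · simp
  refine (mul_nonneg (hg0 1) (hc 1 le_rfl hn)).trans ?_
  refine Nat.decreasingInduction'
    (P := fun j => g j * ∑ i ∈ Icc j n, c i ≤ ∑ i ∈ Icc j n, c i * g i) ?_ hn (by simp [mul_comm])
  intro j hjn hj ih
  rw [← add_sum_Ioc_eq_sum_Icc hjn.le, ← add_sum_Ioc_eq_sum_Icc hjn.le,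
    ← Icc_add_one_left_eq_Ioc]
  have := mul_le_mul_of_nonneg_right (hg j hj hjn) (hc (j + 1) (by omega) hjn)
  linarith [ih]

lemma E_eq_excess {n : ℕ} {a : ℕ → ℝ} (ha : ∀ i ≤ n, 0 < a i) (u k d ξ : ℕ → ℝ) :
    E n u a k d ξ =
      ∑ i ∈ range (n + 1), k i * (u (i + 1) - u i) *
        (-Real.log (cell n a ξ i) - (posSq ξ i + negSq n ξ (i + 1)) / (4 * a i ^ 2))
      + (∑ i ∈ Icc 1 n, (k i / a i ^ 2 * (u (i + 1) - u i) + d i) * posSq ξ i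
        + ∑ i ∈ Icc 1 n, (k (i - 1) / a (i - 1) ^ 2 * (u i - u (i - 1)) + d i) * negSq n ξ i)
        / 4 := by
  have h1 : ∑ i ∈ range (n + 1), k i * (u (i + 1) - u i) *
        (-Real.log (cell n a ξ i) - (posSq ξ i + negSq n ξ (i + 1)) / (4 * a i ^ 2))
      = ∑ i ∈ range (n + 1), k i * (u (i + 1) - u i) * -Real.log (cell n a ξ i)
        - (∑ i ∈ range (n + 1), k i / a i ^ 2 * (u (i + 1) - u i) * posSq ξ i
          + ∑ i ∈ range (n + 1), k i / a i ^ 2 * (u (i + 1) - u i) * negSq n ξ (i + 1)) / 4 := by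
    rw [← sum_add_distrib, sum_div, ← sum_sub_distrib]
    refine sum_congr rfl fun i hi => ?_
    have := ha i (by simpa [Nat.lt_succ_iff] using hi)
    field_simp
  have h2 : ∑ i ∈ Icc 1 n, d i * ξ i ^ 2 / 4
      = (∑ i ∈ Icc 1 n, d i * posSq ξ i + ∑ i ∈ Icc 1 n, d i * negSq n ξ i) / 4 := by
    rw [← sum_add_distrib, sum_div]
    refine sum_congr rfl fun i hi => ?_
    rw [mem_Icc] at hi
    rw [posSq, negSq, if_neg (by omega), if_neg (by omega)]
    rcases le_total 0 (ξ i) with h | h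
    · rw [max_eq_left h, max_eq_right (by linarith)]
      ring
    · rw [max_eq_right h, max_eq_left (by linarith)]
      ring
  have h3 : posSq ξ 0 = 0 := by simp [posSq]
  have h4 : negSq n ξ (n + 1) = 0 := by simp [negSq]
  rw [E_eq_sum_cell, h1, h2, sum_range_succ' (fun i => _ * posSq ξ i),
    sum_range_succ (fun i => _ * negSq n ξ (i + 1)), h3, h4]
  simp only [add_mul, sum_add_distrib]
  rw [sum_Icc_one_eq n fun i => k i / _ * _ * _,
    sum_Icc_one_eq n fun i => k (i - 1) / _ * _ * _]
  simp only [Nat.add_sub_cancel]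
  ring

section Coercive

variable {n : ℕ} {u a k d ξ : ℕ → ℝ}

lemma excess_le_E (hn : 1 ≤ n) (hu : ∀ i ≤ n, u i < u (i + 1)) (ha : ∀ i ≤ n, 0 < a i)
    (hk : ∀ i ≤ n, 0 < k i)
    (h1 : ∀ j, 1 ≤ j → j ≤ n →
      0 ≤ ∑ i ∈ Icc 1 j, (k (i - 1) / a (i - 1) ^ 2 * (u i - u (i - 1)) + d i))
    (h2 : ∀ j, 1 ≤ j → j ≤ n →
      0 ≤ ∑ i ∈ Icc j n, (k i / a i ^ 2 * (u (i + 1) - u i) + d i))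
    (hξ : ∀ i, 1 ≤ i → i < n → ξ i < ξ (i + 1)) {i : ℕ} (hi : i ≤ n) :
    k i * (u (i + 1) - u i) *
      (-Real.log (cell n a ξ i) - (posSq ξ i + negSq n ξ (i + 1)) / (4 * a i ^ 2))
      ≤ E n u a k d ξ := by
  have hp : 0 ≤ ∑ i ∈ Icc 1 n, (k i / a i ^ 2 * (u (i + 1) - u i) + d i) * posSq ξ i := by
    refine sum_Icc_mul_nonneg_of_monotone h2 (fun j hj hjn => ?_) fun j => ?_
    · rw [posSq, posSq, if_neg (by omega), if_neg (by omega)]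
      gcongr
      exact (hξ j hj hjn).le
    · unfold posSq
      split_ifs <;> positivity
  have hq : 0 ≤ ∑ i ∈ Icc 1 n,
      (k (i - 1) / a (i - 1) ^ 2 * (u i - u (i - 1)) + d i) * negSq n ξ i := by
    refine sum_Icc_mul_nonneg_of_antitone h1 (fun j hj hjn => ?_) fun j => ?_
    · rw [negSq, negSq, if_neg (by omega), if_neg (by omega)]
      gcongr
      exact (hξ j hj hjn).le
    · unfold negSq
      split_ifs <;> positivity
  have hs := single_le_sum (s := range (n + 1)) (a := i)
    (f := fun i => k i * (u (i + 1) - u i) *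
      (-Real.log (cell n a ξ i) - (posSq ξ i + negSq n ξ (i + 1)) / (4 * a i ^ 2)))
    (fun j hj => by
      have hj : j ≤ n := by simpa [Nat.lt_succ_iff] using hj
      refine mul_nonneg (mul_nonneg (hk j hj).le (sub_nonneg.2 (hu j hj).le)) ?_
      linarith [log_cell_le hn hj (ha j hj) hξ])
    (by simpa [Nat.lt_succ_iff] using hi)
  rw [E_eq_excess ha]
  linarith

lemma le_mul_exp_of_mul_log_le {w b x c : ℝ} (hw : 0 < w) (hb : 0 < b)
    (h : 0 < x → w * Real.log (x / b) ≤ c) : x ≤ b * Real.exp (c / w) := by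
  rcases le_or_gt x 0 with hx | hx
  · exact hx.trans (by positivity)
  · rw [← div_le_iff₀' hb, ← Real.log_le_iff_le_exp (by positivity), le_div_iff₀' hw]
    exact h hx

lemma exists_abs_le_of_E_le (hn : 1 ≤ n) (hu : ∀ i ≤ n, u i < u (i + 1))
    (ha : ∀ i ≤ n, 0 < a i) (hk : ∀ i ≤ n, 0 < k i)
    (h1 : ∀ j, 1 ≤ j → j ≤ n →
      0 ≤ ∑ i ∈ Icc 1 j, (k (i - 1) / a (i - 1) ^ 2 * (u i - u (i - 1)) + d i))
    (h2 : ∀ j, 1 ≤ j → j ≤ n →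
      0 ≤ ∑ i ∈ Icc j n, (k i / a i ^ 2 * (u (i + 1) - u i) + d i)) (c : ℝ) :
    ∃ M, ∀ ξ : ℕ → ℝ, (∀ i, 1 ≤ i → i < n → ξ i < ξ (i + 1)) → E n u a k d ξ ≤ c →
      ∀ i, 1 ≤ i → i ≤ n → |ξ i| ≤ M := by
  have hw : ∀ i ≤ n, 0 < k i * (u (i + 1) - u i) := fun i hi =>
    mul_pos (hk i hi) (sub_pos.2 (hu i hi))
  refine ⟨max (a n * Real.exp (c / (k n * (u (n + 1) - u n))))
    (a 0 * Real.exp (c / (k 0 * (u (0 + 1) - u 0)))), fun ξ hξ hE i hi hin => ?_⟩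
  have hmono : ∀ i j, 1 ≤ i → i ≤ j → j ≤ n → ξ i ≤ ξ j := by
    intro i j hi hij
    induction j, hij using Nat.le_induction with
    | base => simp
    | succ j hj ih => exact fun hjn => (ih (by omega)).trans (hξ j (by omega) hjn).le
  have hexc := fun {i : ℕ} (hi : i ≤ n) =>
    (excess_le_E hn hu ha hk h1 h2 hξ hi).trans hE
  rw [abs_le', le_max_iff, le_max_iff]
  constructor
  · left
    refine (hmono i n hi hin le_rfl).trans ?_
    refine le_mul_exp_of_mul_log_le (hw n le_rfl) (ha n le_rfl) fun hx => ?_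
    refine le_trans ?_ (hexc le_rfl)
    have hlog := log_F_neg_le (div_pos hx (ha n le_rfl))
    rw [F_neg] at hlog
    rw [cell, if_pos rfl, if_neg (by omega), posSq, negSq, if_neg (by omega), if_pos rfl,
      max_eq_left hx.le]
    refine mul_le_mul_of_nonneg_left ?_ (hw n le_rfl).le
    have : (ξ n / a n) ^ 2 / 4 = (ξ n ^ 2 + 0) / (4 * a n ^ 2) := by
      have := ha n le_rfl
      field_simp
      ring
    linarith
  · right
    refine (neg_le_neg (hmono 1 i le_rfl hi hin)).trans ?_
    refine le_mul_exp_of_mul_log_le (hw 0 (by omega)) (ha 0 (by omega)) fun hx => ?_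
    refine le_trans ?_ (hexc (Nat.zero_le n))
    have hlog := log_F_neg_le (div_pos hx (ha 0 (by omega)))
    rw [cell, if_neg (by omega), if_pos rfl, posSq, negSq, if_pos rfl, if_neg (by omega),
      zero_add, max_eq_left hx.le]
    refine mul_le_mul_of_nonneg_left ?_ (hw 0 (by omega)).le
    have h3 : (-ξ 1 / a 0) ^ 2 / 4 = (0 + (-ξ 1) ^ 2) / (4 * a 0 ^ 2) := by
      have := ha 0 (by omega)
      field_simp
      ring
    rw [← neg_div, neg_neg] at hlog
    rw [sub_zero]
    linarith

lemma exists_le_cell_of_E_le (hn : 1 ≤ n) (hu : ∀ i ≤ n, u i < u (i + 1))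
    (ha : ∀ i ≤ n, 0 < a i) (hk : ∀ i ≤ n, 0 < k i) (c M : ℝ) :
    ∃ δ : ℕ → ℝ, (∀ i, 0 < δ i) ∧ ∀ ξ : ℕ → ℝ, (∀ i, 1 ≤ i → i < n → ξ i < ξ (i + 1)) →
      E n u a k d ξ ≤ c → (∀ i, 1 ≤ i → i ≤ n → |ξ i| ≤ M) →
      ∀ i ≤ n, δ i ≤ cell n a ξ i := by
  have hw : ∀ i ≤ n, 0 < k i * (u (i + 1) - u i) := fun i hi =>
    mul_pos (hk i hi) (sub_pos.2 (hu i hi))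
  refine ⟨fun i => Real.exp (-((c + ∑ i ∈ Icc 1 n, |d i| * M ^ 2 / 4) /
    (k i * (u (i + 1) - u i)))), fun i => Real.exp_pos _, fun ξ hξ hE hM i hi => ?_⟩
  have hpos := fun j (hj : j ≤ n) => cell_pos hn hj (ha j hj) hξ
  have hs := single_le_sum (s := range (n + 1)) (a := i)
    (f := fun i => k i * (u (i + 1) - u i) * -Real.log (cell n a ξ i))
    (fun j hj => by
      have hj : j ≤ n := by simpa [Nat.lt_succ_iff] using hj
      exact mul_nonneg (hw j hj).le
        (neg_nonneg.2 (Real.log_nonpos (hpos j hj).le cell_le_one)))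
    (by simpa [Nat.lt_succ_iff] using hi)
  have hd : -∑ i ∈ Icc 1 n, |d i| * M ^ 2 / 4 ≤ ∑ i ∈ Icc 1 n, d i * ξ i ^ 2 / 4 := by
    rw [← sum_neg_distrib]
    refine sum_le_sum fun j hj => ?_
    rw [mem_Icc] at hj
    have h1 : ξ j ^ 2 ≤ M ^ 2 := sq_le_sq' (by linarith [abs_le.1 (hM j hj.1 hj.2)])
      (le_of_abs_le (hM j hj.1 hj.2))
    have h2 := mul_le_mul_of_nonneg_left h1 (abs_nonneg (d j))
    have h3 := mul_le_mul_of_nonneg_right (neg_abs_le (d j)) (sq_nonneg (ξ j))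
    linarith
  rw [E_eq_sum_cell] at hE
  rw [← Real.le_log_iff_exp_le (hpos i hi), neg_le, le_div_iff₀' (hw i hi)]
  linarith

end Coercive

lemma toSeq_apply {n : ℕ} (x : EuclideanSpace ℝ (Fin n)) {i : ℕ} (h : i - 1 < n) :
    toSeq n x i = x ⟨i - 1, h⟩ := dif_pos h

lemma toSeq_lt_iff {n : ℕ} (x : EuclideanSpace ℝ (Fin n)) :
    (∀ i j : Fin n, i < j → x i < x j) ↔
      ∀ i, 1 ≤ i → i < n → toSeq n x i < toSeq n x (i + 1) := by
  constructor
  · intro h i hi hin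
    rw [toSeq_apply x (by omega), toSeq_apply x (by omega)]
    refine h _ _ ?_
    rw [Fin.lt_def]
    simp only
    omega
  · intro h
    have key : ∀ j, ∀ i : ℕ, 1 ≤ i → i < j → j ≤ n → toSeq n x i < toSeq n x j := by
      intro j i hi hij
      induction j, hij using Nat.le_induction with
      | base => exact fun hin => h i hi hin
      | succ j hj ih =>
        exact fun hjn => (ih (by omega)).trans (h j (by omega) hjn)
    intro i j hij
    have := key (j + 1) (i + 1) (by omega) (by simpa using hij) j.2
    rwa [toSeq_apply x (i := i + 1) (by simp), toSeq_apply x (i := j + 1) (by simp)] at this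

lemma continuous_toSeq (n i : ℕ) : Continuous fun x => toSeq n x i := by
  unfold toSeq
  split_ifs <;> fun_prop

lemma continuous_cell_toSeq (n : ℕ) (a : ℕ → ℝ) (i : ℕ) :
    Continuous fun x => cell n a (toSeq n x) i := by
  have h := fun (b : ℝ) j => F_continuous.comp ((continuous_toSeq n j).div_const b)
  unfold cell
  refine Continuous.sub ?_ ?_
  · split_ifs
    · exact continuous_const
    · exact h _ _
  · split_ifs
    · exact continuous_const
    · exact h _ _

lemma isCompact_sublevel {n : ℕ} {u a k d : ℕ → ℝ} (hn : 1 ≤ n)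
    (hu : ∀ i ≤ n, u i < u (i + 1)) (ha : ∀ i ≤ n, 0 < a i) (hk : ∀ i ≤ n, 0 < k i)
    (h1 : ∀ j, 1 ≤ j → j ≤ n →
      0 ≤ ∑ i ∈ Icc 1 j, (k (i - 1) / a (i - 1) ^ 2 * (u i - u (i - 1)) + d i))
    (h2 : ∀ j, 1 ≤ j → j ≤ n →
      0 ≤ ∑ i ∈ Icc j n, (k i / a i ^ 2 * (u (i + 1) - u i) + d i)) (c : ℝ) :
    IsCompact {x : EuclideanSpace ℝ (Fin n) |
      (∀ i j : Fin n, i < j → x i < x j) ∧ E n u a k d (toSeq n x) ≤ c} := by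
  obtain ⟨M, hM⟩ := exists_abs_le_of_E_le hn hu ha hk h1 h2 c
  obtain ⟨δ, hδ, hcell⟩ := exists_le_cell_of_E_le (d := d) hn hu ha hk c M
  set K : Set (EuclideanSpace ℝ (Fin n)) := {x | ∀ i ≤ n, δ i ≤ cell n a (toSeq n x) i}
  have hK : IsClosed K := by
    simp only [K, Set.ofPred_forall]
    exact isClosed_iInter fun i => isClosed_iInter fun _ =>
      isClosed_le continuous_const (continuous_cell_toSeq n a i)
  have hcont : ContinuousOn (fun x => E n u a k d (toSeq n x)) K := by
    simp only [E_eq_sum_cell]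
    refine ContinuousOn.add (continuousOn_finsetSum _ fun i hi => ?_)
      (Continuous.continuousOn (continuous_finsetSum _ fun i _ => ?_))
    · refine continuousOn_const.mul
        ((continuous_cell_toSeq n a i).continuousOn.log fun x hx => ?_).neg
      exact ((hδ i).trans_le (hx i (by simpa [Nat.lt_succ_iff] using hi))).ne'
    · exact (((continuous_toSeq n i).pow 2).const_mul _).div_const _
  have heq : {x : EuclideanSpace ℝ (Fin n) |
      (∀ i j : Fin n, i < j → x i < x j) ∧ E n u a k d (toSeq n x) ≤ c}
      = K ∩ (fun x => E n u a k d (toSeq n x)) ⁻¹' Set.Iic c := by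
    ext x
    simp only [toSeq_lt_iff, Set.mem_ofPred_eq, Set.mem_inter_iff, Set.mem_preimage, Set.mem_Iic]
    constructor
    · rintro ⟨hx, hE⟩
      exact ⟨hcell _ hx hE (hM _ hx hE), hE⟩
    · rintro ⟨hx, hE⟩
      exact ⟨fun i hi hin => lt_of_cell_pos hi hin (ha i hin.le)
        ((hδ i).trans_le (hx i hin.le)), hE⟩
  refine Metric.isCompact_of_isClosed_isBounded ?_ ?_
  · rw [heq]
    exact hcont.preimage_isClosed_of_isClosed hK isClosed_Iic
  · refine (Metric.isBounded_closedBall (x := (0 : EuclideanSpace ℝ (Fin n)))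
      (r := √(∑ _i : Fin n, M ^ 2))).subset ?_
    rintro x ⟨hx, hE⟩
    rw [mem_closedBall_zero_iff, EuclideanSpace.norm_eq]
    refine Real.sqrt_le_sqrt (sum_le_sum fun i _ => ?_)
    have := hM _ ((toSeq_lt_iff x).1 hx) hE (i + 1) (by omega) i.2
    rw [toSeq_apply x (by simp)] at this
    exact pow_le_pow_left₀ (norm_nonneg _) this 2

lemma neg_log_cell_le {n i : ℕ} {a ξ : ℕ → ℝ} {τ R : ℝ} (hi : i ≤ n) (ha : 0 < a i)
    (hR : 0 ≤ R) (hτ : |τ| ≤ 1) (hlo : i ≠ 0 → ξ i ≤ i + R * τ)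
    (hhi : i ≠ n → i + 1 + R * τ ≤ ξ (i + 1)) :
    -Real.log (cell n a ξ i) ≤ Real.log (2 * √π * a i)
      + ((n + 1) ^ 2 + 2 * (n + 1) * R + R ^ 2 * τ ^ 2) / (4 * a i ^ 2) := by
  obtain ⟨hτ1, hτ2⟩ := abs_le.1 hτ
  have hin : (i : ℝ) ≤ n := by exact_mod_cast hi
  have hi0 : (0 : ℝ) ≤ i := by positivity
  set M : ℝ := ((n + 1) ^ 2 + 2 * (n + 1) * R + R ^ 2 * τ ^ 2) / a i ^ 2 with hM
  have hsq : ∀ b : ℝ, 0 ≤ b → b ≤ n + 1 → ((b + R * τ) / a i) ^ 2 ≤ M := by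
    intro b hb0 hb
    rw [hM, div_pow]
    gcongr
    have h1 : b * (R * τ) ≤ (n + 1) * R :=
      (mul_le_mul_of_nonneg_left (mul_le_of_le_one_right hR hτ2) hb0).trans
        (mul_le_mul_of_nonneg_right hb hR)
    nlinarith
  have hF := mul_F'_le_F_sub (x := (i + R * τ) / a i) (y := (i + 1 + R * τ) / a i) (M := M)
    (by gcongr; linarith) (hsq i hi0 (by linarith)) (hsq (i + 1) (by linarith) (by linarith))
  have hcell : F ((i + 1 + R * τ) / a i) - F ((i + R * τ) / a i) ≤ cell n a ξ i := by
    unfold cell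
    refine sub_le_sub ?_ ?_
    · split_ifs with h
      · exact (F_lt_one _).le
      · exact F_strictMono.monotone (div_le_div_of_nonneg_right (hhi h) ha.le)
    · split_ifs with h
      · exact (F_pos _).le
      · exact F_strictMono.monotone (div_le_div_of_nonneg_right (hlo h) ha.le)
  have hexp : (2 * √π * a i)⁻¹ * Real.exp (-M / 4) ≤ cell n a ξ i := by
    refine le_trans (le_of_eq ?_) (hF.trans hcell)
    field_simp
    ring
  have hπ : (0 : ℝ) < √π := by positivity
  have hlog := Real.log_le_log (by positivity) hexp
  rw [Real.log_mul (by positivity) (by positivity), Real.log_inv, Real.log_exp] at hlog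
  have : M / 4 = ((n + 1) ^ 2 + 2 * (n + 1) * R + R ^ 2 * τ ^ 2) / (4 * a i ^ 2) := by
    rw [hM, div_div, mul_comm (4 : ℝ)]
  linarith

/-- The point with coordinates `ξ i = i + R * v i`, `1 ≤ i ≤ n`. -/
noncomputable def ray (n : ℕ) (v : ℕ → ℝ) (R : ℝ) : EuclideanSpace ℝ (Fin n) :=
  WithLp.toLp 2 fun i => ((i : ℕ) + 1 : ℝ) + R * v (i + 1)

lemma toSeq_ray {n i : ℕ} (v : ℕ → ℝ) (R : ℝ) (h1 : 1 ≤ i) (h2 : i ≤ n) :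
    toSeq n (ray n v R) i = i + R * v i := by
  obtain ⟨j, rfl⟩ := Nat.exists_eq_add_of_le' h1
  rw [toSeq_apply _ (by simpa using h2)]
  simp [ray]

lemma E_ray_le {n : ℕ} {u a k d v τ : ℕ → ℝ} (hu : ∀ i ≤ n, u i < u (i + 1))
    (ha : ∀ i ≤ n, 0 < a i) (hk : ∀ i ≤ n, 0 < k i)
    (hτ : ∀ i, |τ i| ≤ 1) (hv1 : ∀ i, v i ≤ τ i) (hv2 : ∀ i, τ i ≤ v (i + 1)) :
    ∃ p q : ℝ, ∀ R, 0 ≤ R → E n u a k d (toSeq n (ray n v R)) ≤ p + q * R +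
      (∑ i ∈ range (n + 1), k i / a i ^ 2 * (u (i + 1) - u i) * τ i ^ 2
        + ∑ i ∈ Icc 1 n, d i * v i ^ 2) / 4 * R ^ 2 := by
  refine ⟨∑ i ∈ range (n + 1), k i * (u (i + 1) - u i) *
        (Real.log (2 * √π * a i) + (n + 1) ^ 2 / (4 * a i ^ 2))
      + ∑ i ∈ Icc 1 n, d i * i ^ 2 / 4,
    ∑ i ∈ range (n + 1), k i * (u (i + 1) - u i) * (2 * (n + 1) / (4 * a i ^ 2))
      + ∑ i ∈ Icc 1 n, d i * i * v i / 2, fun R hR => ?_⟩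
  have h1 : ∑ i ∈ range (n + 1), k i * (u (i + 1) - u i) *
        -Real.log (cell n a (toSeq n (ray n v R)) i)
      ≤ ∑ i ∈ range (n + 1), (k i * (u (i + 1) - u i) *
          (Real.log (2 * √π * a i) + (n + 1) ^ 2 / (4 * a i ^ 2))
        + k i * (u (i + 1) - u i) * (2 * (n + 1) / (4 * a i ^ 2)) * R
        + k i / a i ^ 2 * (u (i + 1) - u i) * τ i ^ 2 / 4 * R ^ 2) := by
    refine sum_le_sum fun i hi => ?_
    have hi : i ≤ n := by simpa [Nat.lt_succ_iff] using hi
    have hlog := neg_log_cell_le (ξ := toSeq n (ray n v R)) hi (ha i hi) hR (hτ i)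
      (fun h => by
        rw [toSeq_ray v R (by omega) hi]
        have := mul_le_mul_of_nonneg_left (hv1 i) hR
        linarith)
      (fun h => by
        rw [toSeq_ray v R (by omega) (by omega)]
        have := mul_le_mul_of_nonneg_left (hv2 i) hR
        push_cast
        linarith)
    refine (mul_le_mul_of_nonneg_left hlog
      (mul_pos (hk i hi) (sub_pos.2 (hu i hi))).le).trans (le_of_eq ?_)
    have := ha i hi
    field_simp
    ring
  have h2 : ∑ i ∈ Icc 1 n, d i * toSeq n (ray n v R) i ^ 2 / 4
      = ∑ i ∈ Icc 1 n, (d i * i ^ 2 / 4 + d i * i * v i / 2 * R + d i * v i ^ 2 / 4 * R ^ 2) := by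
    refine sum_congr rfl fun i hi => ?_
    rw [mem_Icc] at hi
    rw [toSeq_ray v R hi.1 hi.2]
    ring
  rw [E_eq_sum_cell, h2]
  refine (add_le_add_left h1 _).trans (le_of_eq ?_)
  simp only [sum_add_distrib, ← sum_mul, ← sum_div]
  ring

lemma nonneg_of_isCompact_sublevel {n j : ℕ} {u a k d v τ : ℕ → ℝ}
    (hu : ∀ i ≤ n, u i < u (i + 1)) (ha : ∀ i ≤ n, 0 < a i) (hk : ∀ i ≤ n, 0 < k i)
    (hτ : ∀ i, |τ i| ≤ 1) (hv1 : ∀ i, v i ≤ τ i) (hv2 : ∀ i, τ i ≤ v (i + 1))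
    (hj : 1 ≤ j) (hjn : j ≤ n) (hvj : |v j| = 1)
    (hcomp : ∀ c : ℝ, IsCompact {x : EuclideanSpace ℝ (Fin n) |
      (∀ i j : Fin n, i < j → x i < x j) ∧ E n u a k d (toSeq n x) ≤ c}) :
    0 ≤ ∑ i ∈ range (n + 1), k i / a i ^ 2 * (u (i + 1) - u i) * τ i ^ 2
        + ∑ i ∈ Icc 1 n, d i * v i ^ 2 := by
  by_contra! hneg
  obtain ⟨p, q, hE⟩ := E_ray_le (d := d) hu ha hk hτ hv1 hv2
  set D := ∑ i ∈ range (n + 1), k i / a i ^ 2 * (u (i + 1) - u i) * τ i ^ 2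
        + ∑ i ∈ Icc 1 n, d i * v i ^ 2
  obtain ⟨M, hM⟩ := (hcomp (p - q ^ 2 / D)).isBounded.exists_norm_le
  have hmem : ∀ R, 0 ≤ R → |(j : ℝ) + R * v j| ≤ M := by
    intro R hR
    refine le_trans ?_ (hM (ray n v R) ⟨(toSeq_lt_iff _).2 fun i hi hin => ?_,
      (hE R hR).trans ?_⟩)
    · rw [← toSeq_ray v R hj hjn, toSeq_apply _ (by omega)]
      exact PiLp.norm_apply_le (ray n v R) _
    · rw [toSeq_ray v R hi hin.le, toSeq_ray v R (by omega) hin]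
      have := mul_le_mul_of_nonneg_left ((hv1 i).trans (hv2 i)) hR
      push_cast
      linarith
    · have h : p - q ^ 2 / D - (p + q * R + D / 4 * R ^ 2) = (D / 2 * R + q) ^ 2 / -D := by
        have := hneg.ne
        field_simp
        ring
      have : 0 ≤ (D / 2 * R + q) ^ 2 / -D := div_nonneg (sq_nonneg _) (by linarith)
      linarith
  have hM0 : 0 ≤ M := (abs_nonneg _).trans (hmem 0 le_rfl)
  have h1 := hmem (j + M + 1) (by positivity)
  have h2 : |(j + M + 1) * v j| = j + M + 1 := by
    rw [abs_mul, hvj, mul_one, abs_of_nonneg (by positivity)]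
  have h3 := abs_sub_abs_le_abs_sub ((j + M + 1) * v j) (-(j : ℝ))
  rw [h2, abs_neg, Nat.abs_cast, sub_neg_eq_add, add_comm _ (j : ℝ)] at h3
  linarith

/-- The sub-level sets `Ω_c` are compact for every `c ∈ ℝ` if and only if the coercivity
conditions `S^j ≥ 0` and `S_j ≥ 0` hold for all `j = 1,…,n`. -/
theorem stmt6 (n : ℕ) (hn : 1 ≤ n) (u a k d : ℕ → ℝ)
    (hu : ∀ i ≤ n, u i < u (i + 1))
    (ha : ∀ i ≤ n, 0 < a i)
    (hk : ∀ i ≤ n, 0 < k i) :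
    (∀ c : ℝ, IsCompact {x : EuclideanSpace ℝ (Fin n) |
        (∀ i j : Fin n, i < j → x i < x j) ∧ E n u a k d (toSeq n x) ≤ c}) ↔
      ((∀ j, 1 ≤ j → j ≤ n →
          0 ≤ ∑ i ∈ Finset.Icc 1 j, (k (i - 1) / a (i - 1) ^ 2 * (u i - u (i - 1)) + d i)) ∧
        (∀ j, 1 ≤ j → j ≤ n →
          0 ≤ ∑ i ∈ Finset.Icc j n, (k i / a i ^ 2 * (u (i + 1) - u i) + d i))) := by
  refine ⟨fun h => ⟨fun j hj hjn => ?_, fun j hj hjn => ?_⟩,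
    fun ⟨h1, h2⟩ => isCompact_sublevel hn hu ha hk h1 h2⟩
  · have := nonneg_of_isCompact_sublevel (v := fun i => if i ≤ j then -1 else 0)
      (τ := fun i => if i + 1 ≤ j then -1 else 0) hu ha hk
      (fun i => by split_ifs <;> simp) (fun i => by split_ifs <;> first | omega | simp)
      (fun i => le_rfl) hj hjn (by simp) h
    refine this.trans_eq ?_
    rw [sum_add_distrib]
    congr 1
    · rw [sum_Icc_one_eq]
      simp only [ite_pow, mul_ite, Nat.add_sub_cancel]
      norm_num [← sum_filter]
      refine sum_congr ?_ fun _ _ => rfl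
      ext i
      simp
      omega
    · simp only [ite_pow, mul_ite]
      norm_num [← sum_filter]
      refine sum_congr ?_ fun _ _ => rfl
      ext i
      simp
      omega
  · have := nonneg_of_isCompact_sublevel (v := fun i => if j ≤ i then 1 else 0)
      (τ := fun i => if j ≤ i then 1 else 0) hu ha hk
      (fun i => by split_ifs <;> simp) (fun i => le_rfl)
      (fun i => by split_ifs <;> first | omega | simp) hj hjn (by simp) h
    refine this.trans_eq ?_
    rw [sum_add_distrib]
    congr 1
    all_goals
      simp only [ite_pow, mul_ite]
      norm_num [← sum_filter]
      refine sum_congr ?_ fun _ _ => rfl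
      ext i
      simp
      omega
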